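/- There exists an absolute constant K > 0 such that for all X > 0 and all φ ≥ 0, ∫_0^∞ min{ 1, 1/(X·|cosh ξ − cosh φ|) } dξ ≤ K·(1 + |log X| + φ) / ( 1 + X^{1/2} + sinh(φ)·X ). -/

import Mathlib

open MeasureTheory Set

lemma cosh_sub_one_le_cosh_add_sub {a u : ℝ} (ha : 0 ≤ a) (hu : 0 ≤ u) :
    Real.cosh u - 1 ≤ Real.cosh (a + u) - Real.cosh a := by
  rw [Real.cosh_add]
  have h1 := Real.one_le_cosh a
  have h2 := Real.one_le_cosh u
  have h3 := mul_nonneg (Real.sinh_nonneg_iff.2 ha) (Real.sinh_nonneg_iff.2 hu)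
  nlinarith

lemma sinh_mul_sinh_le_cosh_add_sub (a u : ℝ) :
    Real.sinh a * Real.sinh u ≤ Real.cosh (a + u) - Real.cosh a := by
  rw [Real.cosh_add]
  have h1 := Real.one_le_cosh a
  have h2 := Real.one_le_cosh u
  nlinarith

lemma sinh_add_mul_le {a u : ℝ} (ha : 0 ≤ a) (hu : 0 ≤ u) :
    Real.sinh (a + u) * u ≤ (Real.cosh (a + u) - Real.cosh a) * (u + 2) := by
  obtain ⟨q, rfl⟩ : ∃ q, u = 2 * q := ⟨u / 2, by ring⟩
  have hq : 0 ≤ q := by linarith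
  have e1 : a + 2 * q = (a + q) + q := by ring
  have e2 : Real.cosh a = Real.cosh ((a + q) - q) := by ring_nf
  have e3 : Real.sinh a = Real.sinh ((a + q) - q) := by ring_nf
  have h0 : 0 ≤ Real.sinh a := Real.sinh_nonneg_iff.2 ha
  rw [e1, e2, Real.cosh_add, Real.cosh_sub, Real.sinh_add]
  rw [e3, Real.sinh_sub] at h0
  have h1 : q ≤ Real.sinh q := Real.self_le_sinh_iff.2 hq
  have h2 : Real.cosh q - Real.sinh q ≤ 1 := by
    rw [Real.cosh_sub_sinh]; exact Real.exp_le_one_iff.2 (by linarith)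
  have h3 : 0 ≤ Real.sinh (a + q) := Real.sinh_nonneg_iff.2 (by linarith)
  have h4 : q * Real.cosh q ≤ (q + 1) * Real.sinh q := by nlinarith
  have h5 := mul_le_mul_of_nonneg_left h4 h3
  nlinarith
lemma one_add_sq_div_two_le_cosh (u : ℝ) : 1 + u ^ 2 / 2 ≤ Real.cosh u := by
  have h : Real.cosh u = 1 + 2 * Real.sinh (u / 2) ^ 2 := by
    rw [show u = 2 * (u / 2) by ring, Real.cosh_two_mul, Real.cosh_sq]
    ring_nf
  have h1 : (u / 2) ^ 2 ≤ Real.sinh (u / 2) ^ 2 := by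
    rw [sq_le_sq]
    rcases le_total 0 (u / 2) with hu | hu
    · have := Real.self_le_sinh_iff.2 hu
      rwa [abs_of_nonneg hu, abs_of_nonneg (hu.trans this)]
    · have := Real.sinh_le_self_iff.2 hu
      rw [abs_of_nonpos hu, abs_of_nonpos (this.trans hu)]
      linarith
  rw [h]
  linarith

section

variable {ξ φ : ℝ}

lemma cosh_abs_sub_sub_one_le (hφ : 0 ≤ φ) (hξ : 0 ≤ ξ) :
    Real.cosh |ξ - φ| - 1 ≤ |Real.cosh ξ - Real.cosh φ| := by
  rcases le_total φ ξ with h | h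
  · have := cosh_sub_one_le_cosh_add_sub hφ (sub_nonneg.2 h)
    rw [add_sub_cancel] at this
    rw [Real.cosh_abs]
    exact this.trans (le_abs_self _)
  · have := cosh_sub_one_le_cosh_add_sub hξ (sub_nonneg.2 h)
    rw [add_sub_cancel] at this
    rw [abs_sub_comm ξ, abs_sub_comm (Real.cosh ξ), Real.cosh_abs]
    exact this.trans (le_abs_self _)

lemma sinh_mul_abs_sub_le (hφ : 0 ≤ φ) (hξ : 0 ≤ ξ) :
    Real.sinh φ * |ξ - φ| ≤ |Real.cosh ξ - Real.cosh φ| * (|ξ - φ| + 2) := by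
  rcases le_total φ ξ with h | h
  · have hu := sub_nonneg.2 h
    have h1 := sinh_mul_sinh_le_cosh_add_sub φ (ξ - φ)
    rw [add_sub_cancel] at h1
    have h2 := mul_le_mul_of_nonneg_left (Real.self_le_sinh_iff.2 hu) (Real.sinh_nonneg_iff.2 hφ)
    have h3 := h1.trans (le_abs_self _)
    rw [abs_of_nonneg hu]
    nlinarith [abs_nonneg (Real.cosh ξ - Real.cosh φ)]
  · have hu := sub_nonneg.2 h
    have h1 := sinh_add_mul_le hξ hu
    rw [add_sub_cancel] at h1
    rw [abs_sub_comm ξ, abs_sub_comm (Real.cosh ξ), abs_of_nonneg hu]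
    exact h1.trans (mul_le_mul_of_nonneg_right (le_abs_self _) (by linarith))

lemma sinh_mul_sinh_abs_sub_le (hξ : 0 ≤ ξ) (h : φ < |ξ - φ|) :
    Real.sinh φ * Real.sinh |ξ - φ| ≤ |Real.cosh ξ - Real.cosh φ| := by
  have hu : 0 ≤ ξ - φ := by
    by_contra! hn
    rw [abs_of_neg hn] at h
    linarith
  have h1 := sinh_mul_sinh_le_cosh_add_sub φ (ξ - φ)
  rw [add_sub_cancel] at h1
  rw [abs_of_nonneg hu]
  exact h1.trans (le_abs_self _)

end

section

variable {r s D u T : ℝ}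

lemma weight_mul_min_le (hr : 0 < r) (hs : 0 ≤ s) (hu : 0 < u)
    (h1 : u ^ 2 / 2 ≤ D) (h2 : s * u ≤ D * (u + 2)) :
    (1 + r + s * r ^ 2) * min 1 (1 / (r ^ 2 * D)) ≤ 2 + 4 / u := by
  have hD : 0 < D := lt_of_lt_of_le (by positivity) h1
  set m := min 1 (1 / (r ^ 2 * D))
  have m1 : m ≤ 1 := min_le_left _ _
  have m2 : m ≤ 1 / (r ^ 2 * D) := min_le_right _ _
  have a : r * m ≤ 2 / u := by
    rcases le_total (r * u) 2 with h | h
    · calc r * m ≤ r := by nlinarith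
        _ ≤ 2 / u := by rwa [le_div_iff₀ hu]
    · calc r * m ≤ r * (1 / (r ^ 2 * D)) := by gcongr
        _ = 1 / (r * D) := by field_simp
        _ ≤ 2 / u := by
          rw [div_le_div_iff₀ (by positivity) hu]
          nlinarith [mul_le_mul_of_nonneg_left h1 hr.le]
  have b : s * r ^ 2 * m ≤ 1 + 2 / u := by
    calc s * r ^ 2 * m ≤ s * r ^ 2 * (1 / (r ^ 2 * D)) := by gcongr
      _ = s / D := by field_simp
      _ ≤ (u + 2) / u := by
        rw [div_le_div_iff₀ hD hu]; linarith
      _ = 1 + 2 / u := by field_simp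
  have e : 4 / u = 2 / u + 2 / u := by ring
  rw [e]
  linarith

lemma weight_mul_min_le_exp (hr : 0 < r) (hs : 0 ≤ s) (hT : 0 ≤ T) (hu : 1 ≤ u)
    (hrT : Real.exp (-T) ≤ r) (hXT : Real.exp (-T) ≤ r ^ 2)
    (h1 : Real.cosh u - 1 ≤ D) (h2 : s * Real.sinh u ≤ D) :
    (1 + r + s * r ^ 2) * min 1 (1 / (r ^ 2 * D)) ≤ 20 * Real.exp (T - u) := by
  have hE : 8 / 3 ≤ Real.exp u := by
    have := Real.exp_le_exp.2 hu
    linarith [Real.exp_one_gt_d9]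
  have hE' : Real.exp (-u) ≤ 1 := Real.exp_le_one_iff.2 (by linarith)
  have hE0 := Real.exp_pos (-u)
  have hD8 : Real.exp u / 8 ≤ D := by
    rw [Real.cosh_eq] at h1; linarith
  have hsinh : Real.exp u / 4 ≤ Real.sinh u := by
    rw [Real.sinh_eq]; linarith
  have hD : 0 < D := by linarith
  set m := min 1 (1 / (r ^ 2 * D))
  have m2 : m ≤ 1 / (r ^ 2 * D) := min_le_right _ _
  have key : ∀ y, Real.exp (-T) ≤ y → 1 / (y * D) ≤ 8 * Real.exp (T - u) := by
    intro y hy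
    have hy0 : 0 < y := (Real.exp_pos _).trans_le hy
    calc 1 / (y * D) ≤ 1 / (Real.exp (-T) * (Real.exp u / 8)) := by gcongr
      _ = 8 * Real.exp (T - u) := by
        rw [Real.exp_sub, Real.exp_neg]; field_simp
  have a : r * m ≤ 8 * Real.exp (T - u) := by
    calc r * m ≤ r * (1 / (r ^ 2 * D)) := by gcongr
      _ = 1 / (r * D) := by field_simp
      _ ≤ _ := key r hrT
  have b : s * r ^ 2 * m ≤ 4 * Real.exp (T - u) := by
    calc s * r ^ 2 * m ≤ s * r ^ 2 * (1 / (r ^ 2 * D)) := by gcongr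
      _ = s / D := by field_simp
      _ ≤ 4 / Real.exp u := by
        rw [div_le_div_iff₀ hD (Real.exp_pos u)]
        nlinarith [mul_le_mul_of_nonneg_left hsinh hs]
      _ ≤ 4 * Real.exp (T - u) := by
        rw [Real.exp_sub, mul_div_assoc']
        gcongr
        linarith [Real.one_le_exp hT]
  linarith [m2.trans (key _ hXT)]

end

/-- A majorant of `u ↦ W * min 1 (1 / (X * |cosh ξ - cosh φ|))` with `u = |ξ - φ|`. -/
noncomputable def kernelMajorant (W δ M : ℝ) : ℝ → ℝ := fun u ↦
  (Icc 0 δ).indicator (fun _ ↦ W) u + (Ioc δ M).indicator (fun u ↦ 2 + 4 / u) u +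
    (Ioi M).indicator (fun u ↦ 20 * Real.exp (M - u)) u

section

variable {W δ M : ℝ}

lemma kernelMajorant_nonneg (hW : 0 ≤ W) (hδ : 0 < δ) (u : ℝ) :
    0 ≤ kernelMajorant W δ M u := by
  unfold kernelMajorant
  refine add_nonneg (add_nonneg ?_ ?_) ?_ <;> refine indicator_nonneg (fun x hx ↦ ?_) u
  · exact hW
  · have : 0 < x := hδ.trans hx.1
    positivity
  · positivity

lemma integrableOn_Ioc_two_add_four_div (hδ : 0 < δ) :
    IntegrableOn (fun u : ℝ ↦ 2 + 4 / u) (Ioc δ M) := by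
  refine (ContinuousOn.integrableOn_Icc ?_).mono_set Ioc_subset_Icc_self
  exact continuousOn_const.add (continuousOn_const.div continuousOn_id
    fun x hx ↦ (hδ.trans_le hx.1).ne')

lemma integrableOn_Ioi_exp_sub : IntegrableOn (fun u ↦ 20 * Real.exp (M - u)) (Ioi M) := by
  simp_rw [sub_eq_add_neg, Real.exp_add]
  exact ((integrableOn_exp_neg_Ioi M).const_mul _).const_mul _

lemma integrable_kernelMajorant (hδ : 0 < δ) : Integrable (kernelMajorant W δ M) := by
  refine Integrable.add (Integrable.add ?_ ?_) ?_
  · exact (integrable_indicator_iff measurableSet_Icc).2 (by simp)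
  · exact (integrable_indicator_iff measurableSet_Ioc).2 (integrableOn_Ioc_two_add_four_div hδ)
  · exact (integrable_indicator_iff measurableSet_Ioi).2 integrableOn_Ioi_exp_sub

lemma integral_kernelMajorant (hδ : 0 < δ) (hM : δ ≤ M) :
    ∫ u, kernelMajorant W δ M u = δ * W + (2 * (M - δ) + 4 * Real.log (M / δ)) + 20 := by
  unfold kernelMajorant
  have i1 : Integrable ((Icc 0 δ).indicator (fun _ ↦ W)) :=
    (integrable_indicator_iff measurableSet_Icc).2 (by simp)
  have i2 : Integrable ((Ioc δ M).indicator (fun u ↦ 2 + 4 / u)) :=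
    (integrable_indicator_iff measurableSet_Ioc).2 (integrableOn_Ioc_two_add_four_div hδ)
  have i3 : Integrable ((Ioi M).indicator (fun u ↦ 20 * Real.exp (M - u))) :=
    (integrable_indicator_iff measurableSet_Ioi).2 integrableOn_Ioi_exp_sub
  rw [integral_add (i1.fun_add i2) i3, integral_add i1 i2, integral_indicator measurableSet_Icc,
    integral_indicator measurableSet_Ioc, integral_indicator measurableSet_Ioi]
  congr 1
  · congr 1
    · simp [hδ.le]
    · have h0 : (0 : ℝ) ∉ uIcc δ M := by
        rw [uIcc_of_le hM]; exact fun h ↦ hδ.not_ge h.1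
      rw [← intervalIntegral.integral_of_le hM, intervalIntegral.integral_add (by simp)]
      · simp_rw [div_eq_mul_inv]
        rw [intervalIntegral.integral_const_mul, integral_inv h0]
        simp [div_eq_mul_inv]; ring
      · exact ContinuousOn.intervalIntegrable (continuousOn_const.div continuousOn_id
          fun x hx h ↦ h0 (h ▸ hx))
  · simp_rw [sub_eq_add_neg, Real.exp_add]
    rw [integral_const_mul, integral_const_mul, integral_exp_neg_Ioi, ← Real.exp_add]
    simp

end

theorem cosh_measure_bound_large_alpha :
    ∃ K : ℝ, 0 < K ∧
      ∀ (X φ : ℝ), 0 < X → 0 ≤ φ →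
        (∫ ξ in Set.Ioi (0:ℝ), min 1 (1 / (X * |Real.cosh ξ - Real.cosh φ|))) ≤
          K * (1 + |Real.log X| + φ) /
            (1 + X ^ ((1:ℝ)/2) + Real.sinh φ * X) := by
  refine ⟨50, by norm_num, fun X φ hX hφ ↦ ?_⟩
  rw [← Real.sqrt_eq_rpow]
  set r := √X with hr_def
  have hr : 0 < r := Real.sqrt_pos.2 hX
  have hrX : r ^ 2 = X := Real.sq_sqrt hX.le
  have hs : 0 ≤ Real.sinh φ := Real.sinh_nonneg_iff.2 hφ
  set L := |Real.log X| with hL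
  have hL0 : 0 ≤ L := abs_nonneg _
  have hXL : X ≤ Real.exp L := by
    rw [← Real.log_le_iff_le_exp hX]; exact le_abs_self _
  have hlogr : Real.log r = Real.log X / 2 := Real.log_sqrt hX.le
  have hXL' : Real.exp (-L) ≤ X := by
    rw [← Real.le_log_iff_exp_le hX]; exact neg_abs_le _
  have hrL : r ≤ Real.exp L := by
    rw [← Real.log_le_iff_le_exp hr, hlogr]; linarith [le_abs_self (Real.log X)]
  have hrL' : Real.exp (-L) ≤ r := by
    rw [← Real.le_log_iff_exp_le hr, hlogr]; linarith [neg_abs_le (Real.log X)]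
  set T := φ + L with hT
  have hT0 : 0 ≤ T := by positivity
  have hLT : Real.exp L ≤ Real.exp T := Real.exp_le_exp.2 (by linarith)
  have hLT' : Real.exp (-T) ≤ Real.exp (-L) := Real.exp_le_exp.2 (by linarith)
  set δ := Real.exp (-T) with hδ
  set M := 1 + T with hM
  have hδ0 : 0 < δ := Real.exp_pos _
  have hδ1 : δ ≤ 1 := Real.exp_le_one_iff.2 (by linarith)
  set W := 1 + r + Real.sinh φ * X with hW
  have hW0 : 0 < W := by positivity
  have hδW : δ * W ≤ 3 := by
    have hsφ : Real.sinh φ ≤ Real.exp φ := by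
      rw [Real.sinh_eq]; linarith [Real.exp_pos φ, Real.exp_pos (-φ)]
    have h3 : Real.sinh φ * X ≤ Real.exp T := by
      rw [hT, Real.exp_add]; gcongr
    have h4 : W ≤ 3 * Real.exp T := by linarith [Real.one_le_exp hT0]
    calc δ * W ≤ δ * (3 * Real.exp T) := by gcongr
      _ = 3 * (Real.exp (-T) * Real.exp T) := by rw [hδ]; ring
      _ = 3 := by rw [← Real.exp_add]; simp
  set G := kernelMajorant W δ M with hG
  have hG0 : ∀ u, 0 ≤ G u := kernelMajorant_nonneg hW0.le hδ0
  have hGi : Integrable G := integrable_kernelMajorant hδ0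
  have hGle : ∫ u, G u ≤ 25 * (1 + T) := by
    have hlog : Real.log (M / δ) ≤ 2 * T := by
      rw [Real.log_div (by positivity) hδ0.ne', hδ, Real.log_exp]
      linarith [Real.log_le_sub_one_of_pos (show 0 < M by positivity)]
    rw [hG, integral_kernelMajorant hδ0 (by linarith)]
    linarith
  have hpt : ∀ ξ, 0 ≤ ξ → W * min 1 (1 / (X * |Real.cosh ξ - Real.cosh φ|)) ≤ G |ξ - φ| := by
    intro ξ hξ
    have h1 := cosh_abs_sub_sub_one_le hφ hξ
    have h2 := sinh_mul_abs_sub_le hφ hξ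
    have h3 := sinh_mul_sinh_abs_sub_le (φ := φ) hξ
    have hu := abs_nonneg (ξ - φ)
    generalize |ξ - φ| = u at *
    generalize |Real.cosh ξ - Real.cosh φ| = D at *
    rw [hG, kernelMajorant]
    rcases le_or_gt u δ with hu1 | hu1
    · have : W * min 1 (1 / (X * D)) ≤ W := mul_le_of_le_one_right hW0.le (min_le_left _ _)
      simpa [indicator, hu, hu1, hu1.not_gt, (show u ≤ M by linarith).not_gt] using this
    · rcases le_or_gt u M with hu2 | hu2
      · have := weight_mul_min_le hr hs (hδ0.trans hu1)
          (by linarith [one_add_sq_div_two_le_cosh u]) h2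
        rw [hrX] at this
        simpa [indicator, hu1, hu1.not_ge, hu2, hu2.not_gt] using this
      · have := weight_mul_min_le_exp hr hs hT0 (by linarith) (hLT'.trans hrL')
          (by rw [hrX]; exact hLT'.trans hXL') h1 (h3 (by linarith))
        rw [hrX] at this
        have h5 : Real.exp (T - u) ≤ Real.exp (M - u) := Real.exp_le_exp.2 (by linarith)
        have h6 := this.trans (mul_le_mul_of_nonneg_left h5 (by norm_num))
        simpa [indicator, hu1.not_ge, hu2, hu2.not_ge] using h6
  have hsum : Integrable fun ξ ↦ G (ξ - φ) + G (φ - ξ) :=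
    (hGi.comp_sub_right φ).add (hGi.comp_sub_left φ)
  rw [le_div_iff₀ hW0, mul_comm, ← integral_const_mul]
  calc ∫ ξ in Ioi 0, W * min 1 (1 / (X * |Real.cosh ξ - Real.cosh φ|))
      ≤ ∫ ξ in Ioi 0, (G (ξ - φ) + G (φ - ξ)) := by
        refine integral_mono_of_nonneg (.of_forall fun ξ ↦ by positivity) hsum.integrableOn ?_
        filter_upwards [ae_restrict_mem measurableSet_Ioi] with ξ hξ
        refine (hpt ξ (le_of_lt hξ)).trans ?_
        rcases abs_choice (ξ - φ) with h | h <;> rw [h]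
        · linarith [hG0 (φ - ξ)]
        · rw [neg_sub]; linarith [hG0 (ξ - φ)]
    _ ≤ ∫ ξ, (G (ξ - φ) + G (φ - ξ)) :=
        setIntegral_le_integral hsum (.of_forall fun ξ ↦ add_nonneg (hG0 _) (hG0 _))
    _ = 2 * ∫ u, G u := by
        rw [integral_add (hGi.comp_sub_right φ) (hGi.comp_sub_left φ),
          integral_sub_right_eq_self, integral_sub_left_eq_self]
        ring
    _ ≤ 50 * (1 + L + φ) := by linarith
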